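/- arXiv:1702.06019 — 3 statements merged into one kernel-verified Lean document; each statement's English description precedes it below -/
import Mathlib

section
/- Let k be a field of characteristic 2 and let S̄ = k[A,B,C,D,P,Q,R,T][(det Σ)⁻¹, (det Φ)⁻¹] where Σ = (1+A, B; C, 1+D) and Φ = (P, Q; R, T−P). Then the ideal I_N = (A² + BC, CQ + BR, T, A + D) of S̄ is prime of dimension 4; indeed S̄/I_N is isomorphic to a localization of (k[A,B,C]/(A² + BC))[P,Q,R]/(CQ + BR), which is a 4-dimensional integral domain. -/
open MvPolynomial

/-- `det Σ = (1+A)(1+D) − BC`, with `A,B,C,D,P,Q,R,T` the variables `X 0, …, X 7`. -/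
noncomputable def detSigma (k : Type*) [CommRing k] : MvPolynomial (Fin 8) k :=
  (1 + X 0) * (1 + X 3) - X 1 * X 2

/-- `det Φ = P(T−P) − QR`. -/
noncomputable def detPhi (k : Type*) [CommRing k] : MvPolynomial (Fin 8) k :=
  X 4 * (X 7 - X 4) - X 5 * X 6

/-- `S̄ = k[A,B,C,D,P,Q,R,T][(det Σ)⁻¹, (det Φ)⁻¹]`. -/
abbrev Sbar (k : Type*) [CommRing k] :=
  Localization (Submonoid.closure {detSigma k, detPhi k})

/-- The image of a polynomial in `S̄`. -/
noncomputable def toSbar (k : Type*) [CommRing k] (p : MvPolynomial (Fin 8) k) : Sbar k :=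
  algebraMap (MvPolynomial (Fin 8) k) (Sbar k) p

section Order

open Order

/-- A strictly increasing chain of the maximal possible length determines the dimension above each
of its terms. -/
theorem krullDim_Ici_eq_of_strictMono {α : Type*} [PartialOrder α] {m n : ℕ}
    {f : Fin (m + n + 1) → α} (hf : StrictMono f) (hα : krullDim α ≤ (m + n : ℕ))
    (i : Fin (m + n + 1)) (hi : (i : ℕ) = m) : krullDim (Set.Ici (f i)) = n := by
  have : Nonempty α := ⟨f i⟩
  rw [← coheight_eq_krullDim_Ici]
  let s : LTSeries α := LTSeries.mk (m + n) f hf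
  have h₁ : (m : ℕ∞) ≤ height (f i) := by
    simpa [s, hi] using Order.index_le_height s i
  have h₂ : (n : ℕ∞) ≤ coheight (f i) := by
    have := Order.rev_index_le_coheight s i
    have h : ((Fin.rev i : Fin (m + n + 1)) : ℕ) = n := by rw [Fin.val_rev]; omega
    rw [← h]
    exact this
  have h₃ : height (f i) + coheight (f i) ≤ (m + n : ℕ) := by
    rw [krullDim_eq_iSup_height_add_coheight_of_nonempty] at hα
    exact (le_iSup (fun a : α => height a + coheight a) (f i)).trans (by exact_mod_cast hα)
  have h₄ : (m : ℕ∞) + coheight (f i) ≤ m + n := by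
    refine (add_le_add_left h₁ _).trans ?_
    exact_mod_cast h₃
  have h₅ : coheight (f i) = n :=
    le_antisymm ((ENat.add_le_add_iff_left (ENat.natCast_ne_top m)).1 h₄) h₂
  rw [h₅]
  rfl

end Order

theorem AlgHom.ker_lt_ker_of_eq_comp {k R S U : Type*} [CommRing k] [CommRing R] [CommRing S]
    [CommRing U] [Algebra k R] [Algebra k S] [Algebra k U] {f : R →ₐ[k] S} {h : R →ₐ[k] U}
    (g : S →ₐ[k] U) (hg : h = g.comp f) {x : R} (hx : h x = 0) (hx' : f x ≠ 0) :
    RingHom.ker f < RingHom.ker h := by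
  refine SetLike.lt_iff_le_and_exists.2 ⟨fun y hy => ?_, x, hx, hx'⟩
  rw [RingHom.mem_ker] at hy ⊢
  simp [hg, hy]

/-- Normal form of a monomial modulo the relations `a² = bc` and `cq = br`. -/
theorem pow_mul_eq_normalForm {N : Type*} [CommRing N] {a b c q r : N} (h₁ : a ^ 2 = b * c)
    (h₂ : c * q = b * r) (e i j l m : ℕ) :
    a ^ e * b ^ i * c ^ j * q ^ l * r ^ m =
      a ^ (e % 2) * b ^ (e / 2 + i + l - (l + m - min (e / 2 + j + m) (l + m))) *
        c ^ (e / 2 + j + m - min (e / 2 + j + m) (l + m)) *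
        q ^ (l + m - min (e / 2 + j + m) (l + m)) * r ^ min (e / 2 + j + m) (l + m) := by
  have ha : a ^ e = a ^ (e % 2) * (b ^ (e / 2) * c ^ (e / 2)) := by
    rw [← mul_pow, ← h₁, ← pow_mul, ← pow_add, Nat.mod_add_div]
  obtain ⟨t, ht⟩ : ∃ t, t = e / 2 := ⟨_, rfl⟩
  rw [ha, ← ht]
  rcases le_total (t + j) l with h | h
  · obtain ⟨d, rfl⟩ := Nat.exists_eq_add_of_le h
    have e₁ : min (t + j + m) (t + j + d + m) = t + j + m := by omega
    have e₂ : t + i + (t + j + d) - (t + j + d + m - (t + j + m)) = t + i + (t + j) := by omega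
    have e₃ : t + j + m - (t + j + m) = 0 := by omega
    have e₄ : t + j + d + m - (t + j + m) = d := by omega
    rw [e₁, e₂, e₃, e₄]
    calc _ = a ^ (e % 2) * b ^ (t + i) * (c * q) ^ (t + j) * q ^ d * r ^ m := by ring
      _ = _ := by rw [h₂]; ring
  · obtain ⟨d, hd⟩ := Nat.exists_eq_add_of_le h
    have e₁ : min (t + j + m) (l + m) = l + m := by omega
    have e₂ : t + i + l - (l + m - (l + m)) = t + i + l := by omega
    have e₃ : t + j + m - (l + m) = d := by omega
    have e₄ : l + m - (l + m) = 0 := by omega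
    rw [e₁, e₂, e₃, e₄]
    calc _ = a ^ (e % 2) * b ^ (t + i) * c ^ (t + j) * q ^ l * r ^ m := by ring
      _ = a ^ (e % 2) * b ^ (t + i) * (c * q) ^ l * c ^ d * r ^ m := by rw [hd]; ring
      _ = _ := by rw [h₂]; ring

section Chain

variable (k : Type*) [Field k]

/-- The ideal `(A² + BC, CQ + BR, T, A + D)` of the polynomial ring. -/
noncomputable def nilpotentIdeal : Ideal (MvPolynomial (Fin 8) k) :=
  Ideal.span {X 0 ^ 2 + X 1 * X 2, X 2 * X 5 + X 1 * X 6, X 7, X 0 + X 3}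

/-- The parametrization `A = D = st, B = s², C = t², Q = s²u, R = t²u, T = 0`, where
`s, t, u` are the variables `X 0, X 1, X 5`. -/
noncomputable def parametrization : MvPolynomial (Fin 8) k →ₐ[k] MvPolynomial (Fin 8) k :=
  aeval ![X 0 * X 1, X 0 ^ 2, X 1 ^ 2, X 0 * X 1, X 4, X 0 ^ 2 * X 5, X 1 ^ 2 * X 5, 0]

/-- A linear map recovering the class of a polynomial from its image under the parametrization. -/
noncomputable def parametrizationSection :
    MvPolynomial (Fin 8) k →ₗ[k] MvPolynomial (Fin 8) k ⧸ nilpotentIdeal k :=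
  (basisMonomials (Fin 8) k).constr k fun n =>
    Ideal.Quotient.mk (nilpotentIdeal k)
      (X 0 ^ (n 0 % 2) * X 1 ^ (n 0 / 2 - (n 5 - min (n 1 / 2) (n 5))) *
        X 2 ^ (n 1 / 2 - min (n 1 / 2) (n 5)) * X 5 ^ (n 5 - min (n 1 / 2) (n 5)) *
        X 6 ^ min (n 1 / 2) (n 5) * X 4 ^ n 4)

theorem parametrizationSection_monomial (n : Fin 8 →₀ ℕ) :
    parametrizationSection k (monomial n 1) =
      Ideal.Quotient.mk (nilpotentIdeal k)
        (X 0 ^ (n 0 % 2) * X 1 ^ (n 0 / 2 - (n 5 - min (n 1 / 2) (n 5))) *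
          X 2 ^ (n 1 / 2 - min (n 1 / 2) (n 5)) * X 5 ^ (n 5 - min (n 1 / 2) (n 5)) *
          X 6 ^ min (n 1 / 2) (n 5) * X 4 ^ n 4) := by
  have := (basisMonomials (Fin 8) k).constr_basis k (fun n : Fin 8 →₀ ℕ =>
    Ideal.Quotient.mk (nilpotentIdeal k)
      (X 0 ^ (n 0 % 2) * X 1 ^ (n 0 / 2 - (n 5 - min (n 1 / 2) (n 5))) *
        X 2 ^ (n 1 / 2 - min (n 1 / 2) (n 5)) * X 5 ^ (n 5 - min (n 1 / 2) (n 5)) *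
        X 6 ^ min (n 1 / 2) (n 5) * X 4 ^ n 4)) n
  rwa [coe_basisMonomials] at this

theorem monomial_eq_prod_eight (n : Fin 8 →₀ ℕ) :
    (monomial n 1 : MvPolynomial (Fin 8) k) =
      X 0 ^ n 0 * X 1 ^ n 1 * X 2 ^ n 2 * X 3 ^ n 3 * X 4 ^ n 4 * X 5 ^ n 5 * X 6 ^ n 6 *
        X 7 ^ n 7 := by
  rw [monomial_eq, Finsupp.prod_fintype _ _ (by simp), Fin.prod_univ_eight]
  simp

theorem ne_zero_of_eval_eq_one {σ : Type*} {p : MvPolynomial σ k} (x : σ → k) (h : eval x p = 1) :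
    p ≠ 0 := by
  rintro rfl
  simp at h

theorem ringKrullDim_Sbar_le : ringKrullDim (Sbar k) ≤ (4 + 4 : ℕ) := by
  have h : ringKrullDim (MvPolynomial (Fin 8) k) = (4 + 4 : ℕ) := by simp
  rw [← h]
  exact Order.krullDim_le_of_strictMono
    (fun p => (IsLocalization.primeSpectrumOrderIso
      (Submonoid.closure {detSigma k, detPhi k}) (Sbar k) p).1)
    fun _ _ h => (IsLocalization.primeSpectrumOrderIso _ _).strictMono h

/-- Substitutions whose kernels form a saturated chain of primes through the kernel of
the parametrization. -/
noncomputable def chainHom : Fin 9 → MvPolynomial (Fin 8) k →ₐ[k] MvPolynomial (Fin 8) k :=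
  ![AlgHom.id k _,
    aeval ![X 0, X 1, X 2, X 3, X 4, X 5, X 6, 0],
    aeval ![X 0, X 1, X 2, X 0, X 4, X 5, X 6, 0],
    aeval ![X 0 * X 1, X 0 ^ 2, X 1 ^ 2, X 0 * X 1, X 4, X 5, X 6, 0],
    parametrization k,
    aeval ![0, 0, 0, 0, X 4, X 5, X 6, 0],
    aeval ![0, 0, 0, 0, X 4, 0, X 6, 0],
    aeval ![0, 0, 0, 0, X 4, 0, 0, 0],
    aeval ![0, 0, 0, 0, 1, 0, 0, 0]]

variable [CharP k 2]

theorem parametrizationSection_parametrization (p : MvPolynomial (Fin 8) k) :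
    parametrizationSection k (parametrization k p) = Ideal.Quotient.mk (nilpotentIdeal k) p := by
  have hmk : ∀ x y : MvPolynomial (Fin 8) k, x + y ∈ ({X 0 ^ 2 + X 1 * X 2,
      X 2 * X 5 + X 1 * X 6, X 7, X 0 + X 3} : Set (MvPolynomial (Fin 8) k)) →
      Ideal.Quotient.mk (nilpotentIdeal k) x = Ideal.Quotient.mk (nilpotentIdeal k) y :=
    fun x y h => Ideal.Quotient.eq.2 (by
      rw [CharTwo.sub_eq_add]
      exact Ideal.subset_span h)
  suffices h : parametrizationSection k ∘ₗ (parametrization k).toLinearMap =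
      (Ideal.Quotient.mkₐ k (nilpotentIdeal k)).toLinearMap from LinearMap.congr_fun h p
  refine (basisMonomials (Fin 8) k).ext fun n => ?_
  rw [coe_basisMonomials]
  change parametrizationSection k (parametrization k (monomial n 1)) =
    Ideal.Quotient.mk (nilpotentIdeal k) (monomial n 1)
  have hT : Ideal.Quotient.mk (nilpotentIdeal k) (X 7) = 0 :=
    (hmk (X 7) 0 (by simp)).trans (map_zero _)
  have hD := hmk (X 0) (X 3) (by simp)
  have hA := hmk (X 0 ^ 2) (X 1 * X 2) (by simp)
  have hQ := hmk (X 2 * X 5) (X 1 * X 6) (by simp)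
  simp only [map_pow, map_mul] at hA hQ
  rw [monomial_eq_prod_eight]
  rcases Nat.eq_zero_or_pos (n 7) with h7 | h7
  · have hψ : parametrization k (X 0 ^ n 0 * X 1 ^ n 1 * X 2 ^ n 2 * X 3 ^ n 3 * X 4 ^ n 4 *
        X 5 ^ n 5 * X 6 ^ n 6 * X 7 ^ n 7) =
        monomial (Finsupp.single 0 (n 0 + n 3 + 2 * (n 1 + n 5)) +
          Finsupp.single 1 (n 0 + n 3 + 2 * (n 2 + n 6)) + Finsupp.single 4 (n 4) +
          Finsupp.single 5 (n 5 + n 6)) 1 := by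
      have : (monomial (Finsupp.single 0 (n 0 + n 3 + 2 * (n 1 + n 5)) +
          Finsupp.single 1 (n 0 + n 3 + 2 * (n 2 + n 6)) + Finsupp.single 4 (n 4) +
          Finsupp.single 5 (n 5 + n 6)) 1 : MvPolynomial (Fin 8) k) =
          X 0 ^ (n 0 + n 3 + 2 * (n 1 + n 5)) * X 1 ^ (n 0 + n 3 + 2 * (n 2 + n 6)) * X 4 ^ n 4 *
            X 5 ^ (n 5 + n 6) := by
        simp [X_pow_eq_monomial, monomial_mul]
      rw [this]
      simp [parametrization, h7]
      ring
    rw [hψ, parametrizationSection_monomial]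
    have d₁ : (n 0 + n 3 + 2 * (n 1 + n 5)) / 2 = (n 0 + n 3) / 2 + n 1 + n 5 := by omega
    have d₂ : (n 0 + n 3 + 2 * (n 2 + n 6)) / 2 = (n 0 + n 3) / 2 + n 2 + n 6 := by omega
    have d₃ : (n 0 + n 3 + 2 * (n 1 + n 5)) % 2 = (n 0 + n 3) % 2 := by omega
    have hnf := pow_mul_eq_normalForm hA hQ (n 0 + n 3) (n 1) (n 2) (n 5) (n 6)
    simp only [Finsupp.add_apply, Finsupp.single_apply, Fin.reduceEq, if_true, if_false, add_zero,
      zero_add, d₁, d₂, d₃, map_mul, map_pow, ← hD, h7, pow_zero, mul_one]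
    rw [← hnf]
    ring
  · have h0 : (0 : MvPolynomial (Fin 8) k) ^ n 7 = 0 := zero_pow h7.ne'
    simp [parametrization, hT, h0, h7.ne']

theorem ker_parametrization : RingHom.ker (parametrization k) = nilpotentIdeal k := by
  apply le_antisymm
  · intro p hp
    rw [RingHom.mem_ker] at hp
    rw [← Ideal.Quotient.eq_zero_iff_mem, ← parametrizationSection_parametrization, hp, map_zero]
  · rw [nilpotentIdeal, Ideal.span_le]
    rintro x (rfl | rfl | rfl | rfl) <;> rw [SetLike.mem_coe, RingHom.mem_ker]
    · simp only [parametrization, map_add, map_mul, map_pow, aeval_X]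
      exact CharTwo.add_eq_zero.2 (by simp; ring)
    · simp only [parametrization, map_add, map_mul, aeval_X]
      exact CharTwo.add_eq_zero.2 (by simp; ring)
    · simp [parametrization]
    · simp only [parametrization, map_add, aeval_X]
      exact CharTwo.add_eq_zero.2 (by simp)

theorem strictMono_ker_chainHom : StrictMono fun i => RingHom.ker (chainHom k i) := by
  rw [Fin.strictMono_iff_lt_succ]
  intro i
  fin_cases i
  · refine AlgHom.ker_lt_ker_of_eq_comp (aeval ![X 0, X 1, X 2, X 3, X 4, X 5, X 6, 0]) ?_
      (x := X 7) ?_ (X_ne_zero _)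
    · ext j; fin_cases j <;> simp [chainHom]
    · simp [chainHom]
  · refine AlgHom.ker_lt_ker_of_eq_comp (aeval ![X 0, X 1, X 2, X 0, X 4, X 5, X 6, 0]) ?_
      (x := X 0 + X 3) ?_ (ne_zero_of_eval_eq_one k ![1, 0, 0, 0, 0, 0, 0, 0] ?_)
    · ext j; fin_cases j <;> simp [chainHom]
    · simp [chainHom, CharTwo.add_self_eq_zero]
    · simp [chainHom]
  · refine AlgHom.ker_lt_ker_of_eq_comp
      (aeval ![X 0 * X 1, X 0 ^ 2, X 1 ^ 2, X 0 * X 1, X 4, X 5, X 6, 0]) ?_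
      (x := X 0 ^ 2 + X 1 * X 2) ?_ (ne_zero_of_eval_eq_one k ![1, 0, 0, 0, 0, 0, 0, 0] ?_)
    · ext j; fin_cases j <;> simp [chainHom]
    · simp [chainHom, mul_pow, CharTwo.add_self_eq_zero]
    · simp [chainHom]
  · refine AlgHom.ker_lt_ker_of_eq_comp
      (aeval ![X 0, X 1, 0, 0, X 4, X 0 ^ 2 * X 5, X 1 ^ 2 * X 5, 0]) ?_
      (x := X 2 * X 5 + X 1 * X 6) ?_ (ne_zero_of_eval_eq_one k ![0, 1, 0, 0, 0, 1, 0, 0] ?_)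
    · ext j; fin_cases j <;> simp [chainHom, parametrization]
    · simp only [chainHom, parametrization, map_add, map_mul]
      exact CharTwo.add_eq_zero.2 (by simp; ring)
    · simp [chainHom]
  · refine SetLike.lt_iff_le_and_exists.2 ⟨?_, X 0, ?_, ?_⟩
    · change RingHom.ker (parametrization k) ≤ _
      rw [ker_parametrization, nilpotentIdeal, Ideal.span_le]
      rintro x (rfl | rfl | rfl | rfl) <;> simp [chainHom, RingHom.mem_ker]
    · simp [chainHom, RingHom.mem_ker]
    · simp [chainHom, parametrization, RingHom.mem_ker]
  · refine AlgHom.ker_lt_ker_of_eq_comp (aeval ![0, 0, 0, 0, X 4, 0, X 6, 0]) ?_ (x := X 5) ?_ ?_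
    · ext j; fin_cases j <;> simp [chainHom]
    · simp [chainHom]
    · simp [chainHom]
  · refine AlgHom.ker_lt_ker_of_eq_comp (aeval ![0, 0, 0, 0, X 4, 0, 0, 0]) ?_ (x := X 6) ?_ ?_
    · ext j; fin_cases j <;> simp [chainHom]
    · simp [chainHom]
    · simp [chainHom]
  · refine AlgHom.ker_lt_ker_of_eq_comp (aeval ![0, 0, 0, 0, 1, 0, 0, 0]) ?_ (x := X 4 + 1) ?_
      (ne_zero_of_eval_eq_one k ![0, 0, 0, 0, 0, 0, 0, 0] ?_)
    · ext j; fin_cases j <;> simp [chainHom]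
    · simp [chainHom, CharTwo.add_self_eq_zero]
    · simp [chainHom]

theorem disjoint_ker_chainHom (i : Fin 9) :
    Disjoint (Submonoid.closure {detSigma k, detPhi k} : Set (MvPolynomial (Fin 8) k))
      (RingHom.ker (chainHom k i)) := by
  have hlast : Submonoid.closure {detSigma k, detPhi k} ≤
      (nonZeroDivisors (MvPolynomial (Fin 8) k)).comap (chainHom k (Fin.last 8)) := by
    rw [Submonoid.closure_le]
    rintro x (rfl | rfl) <;>
      simp [chainHom, Fin.last, detSigma, detPhi, mem_nonZeroDivisors_iff_ne_zero]
  refine Disjoint.mono_right ((strictMono_ker_chainHom k).monotone (Fin.le_last i)) ?_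
  rw [Set.disjoint_left]
  intro x hx hx'
  exact nonZeroDivisors.ne_zero (hlast hx) hx'

/-- The chain of primes of `S̄` obtained from the kernels of `chainHom`. -/
noncomputable def primeChain (i : Fin 9) : PrimeSpectrum (Sbar k) :=
  (IsLocalization.primeSpectrumOrderIso (Submonoid.closure {detSigma k, detPhi k}) (Sbar k)).symm
    ⟨⟨RingHom.ker (chainHom k i), RingHom.ker_isPrime _⟩, disjoint_ker_chainHom k i⟩

theorem strictMono_primeChain : StrictMono (primeChain k) := fun _ _ h =>
  (OrderIso.strictMono _) (strictMono_ker_chainHom k h)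

theorem primeChain_four_asIdeal : (primeChain k 4).asIdeal =
    Ideal.span {toSbar k (X 0 ^ 2 + X 1 * X 2), toSbar k (X 2 * X 5 + X 1 * X 6),
      toSbar k (X 7), toSbar k (X 0 + X 3)} := by
  change Ideal.map (algebraMap _ (Sbar k)) (RingHom.ker (parametrization k)) = _
  rw [ker_parametrization, nilpotentIdeal, Ideal.map_span]
  simp only [Set.image_insert_eq, Set.image_singleton, toSbar]

end Chain

/-- Let `k` be a field of characteristic `2`.  The ideal
`I_N = (A² + BC, CQ + BR, T, A + D)` of `S̄` is prime of dimension `4`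
(i.e. `S̄/I_N` has Krull dimension `4`). -/
theorem stmt14 {k : Type*} [Field k] [CharP k 2] :
    (Ideal.span {toSbar k (X 0 ^ 2 + X 1 * X 2), toSbar k (X 2 * X 5 + X 1 * X 6),
        toSbar k (X 7), toSbar k (X 0 + X 3)}).IsPrime ∧
    ringKrullDim (Sbar k ⧸ Ideal.span {toSbar k (X 0 ^ 2 + X 1 * X 2),
        toSbar k (X 2 * X 5 + X 1 * X 6), toSbar k (X 7), toSbar k (X 0 + X 3)}) = 4 := by
  rw [← primeChain_four_asIdeal]
  refine ⟨(primeChain k 4).isPrime, ?_⟩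
  rw [ringKrullDim_quotient]
  have h := krullDim_Ici_eq_of_strictMono (m := 4) (n := 4) (strictMono_primeChain k)
    (ringKrullDim_Sbar_le k) 4 rfl
  have hset : PrimeSpectrum.zeroLocus ((primeChain k 4).asIdeal : Set (Sbar k)) =
      Set.Ici (primeChain k 4) := rfl
  rw [hset]
  exact h
end

section
/- Let k be a field of characteristic 2 and S̄ as above, with I₁ = (A,B,C,D) and I_N = (A²+BC, CQ+BR, T, A+D). Then I₁ ∩ I_N = (A+D, AT, BT, CT, A² + BC, BR + CQ). Moreover I₁ + I_N = (A, B, C, D, T), and S̄/(I₁ ∩ I_N) is Cohen–Macaulay of dimension 4. -/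
open MvPolynomial

/-- The ideal `I₁ = (A, B, C, D)`. -/
noncomputable def Ione (k : Type*) [CommRing k] : Ideal (Sbar k) :=
  Ideal.span {toSbar k (X 0), toSbar k (X 1), toSbar k (X 2), toSbar k (X 3)}

/-- The ideal `I_N = (A² + BC, CQ + BR, T, A + D)`. -/
noncomputable def IN (k : Type*) [CommRing k] : Ideal (Sbar k) :=
  Ideal.span {toSbar k (X 0 ^ 2 + X 1 * X 2), toSbar k (X 2 * X 5 + X 1 * X 6),
    toSbar k (X 7), toSbar k (X 0 + X 3)}

/-- A Noetherian local ring is Cohen–Macaulay if it admits a regular sequence of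
elements of the maximal ideal whose length equals the Krull dimension. -/
def IsCohenMacaulayLocalRing (R : Type*) [CommRing R] [IsLocalRing R] : Prop :=
  ∃ rs : List R, (∀ r ∈ rs, r ∈ IsLocalRing.maximalIdeal R) ∧
    RingTheory.Sequence.IsRegular R rs ∧
    ringKrullDim R = rs.length

/-- A commutative ring is Cohen–Macaulay if all its localizations at primes are
Cohen–Macaulay local rings. -/
def IsCohenMacaulayRing (R : Type*) [CommRing R] : Prop :=
  ∀ 𝔭 : PrimeSpectrum R, IsCohenMacaulayLocalRing (Localization.AtPrime 𝔭.asIdeal)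

open RingTheory.Sequence in
/-- In a Noetherian local ring, a weakly regular sequence in the maximal ideal whose length is at
least the Krull dimension witnesses Cohen–Macaulayness. -/
lemma IsCohenMacaulayLocalRing.of_isWeaklyRegular {R : Type*} [CommRing R] [IsLocalRing R]
    [IsNoetherianRing R] (rs : List R) (hmem : ∀ r ∈ rs, r ∈ IsLocalRing.maximalIdeal R)
    (hreg : IsWeaklyRegular R rs) (hdim : ringKrullDim R ≤ rs.length) :
    IsCohenMacaulayLocalRing R := by
  have hreg' : IsRegular R rs := .of_isWeaklyRegular_of_mem_maximalIdeal _ hmem hreg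
  refine ⟨rs, hmem, hreg', hdim.antisymm ?_⟩
  have hle : Ideal.ofList rs ≤ IsLocalRing.maximalIdeal R := Ideal.span_le.mpr hmem
  have : Nontrivial (R ⧸ Ideal.ofList rs) :=
    Ideal.Quotient.nontrivial_iff.mpr (ne_top_of_le_ne_top Ideal.IsPrime.ne_top' hle)
  rw [← ringKrullDim_add_length_eq_ringKrullDim_of_isRegular rs hreg']
  exact le_add_of_nonneg_left ringKrullDim_nonneg_of_nontrivial

open RingTheory.Sequence in
/-- Cohen–Macaulayness ascends along a flat local homomorphism that does not raise the
dimension. -/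
lemma IsCohenMacaulayLocalRing.of_flat {R S : Type*} [CommRing R] [CommRing S] [IsLocalRing R]
    [IsLocalRing S] [IsNoetherianRing S] [Algebra R S] [Module.Flat R S]
    [IsLocalHom (algebraMap R S)] (hR : IsCohenMacaulayLocalRing R)
    (hdim : ringKrullDim S ≤ ringKrullDim R) : IsCohenMacaulayLocalRing S := by
  obtain ⟨rs, hmem, hreg, hlen⟩ := hR
  refine .of_isWeaklyRegular (rs.map (algebraMap R S)) ?_ hreg.1.of_flat ?_
  · simp only [List.mem_map, forall_exists_index, and_imp, forall_apply_eq_imp_iff₂]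
    exact fun r hr ↦ (IsLocalRing.maximalIdeal_comap (algebraMap R S)).ge (hmem r hr)
  · rwa [List.length_map, ← hlen]

lemma IsCohenMacaulayLocalRing.of_ringEquiv {R S : Type*} [CommRing R] [CommRing S]
    [IsLocalRing R] [IsLocalRing S] [IsNoetherianRing S] (e : R ≃+* S)
    (hR : IsCohenMacaulayLocalRing R) : IsCohenMacaulayLocalRing S := by
  algebraize [e.toRingHom]
  have : Module.Flat R S :=
    .of_linearEquiv (AlgEquiv.ofRingEquiv (f := e) fun _ ↦ rfl).symm.toLinearEquiv
  have : IsLocalHom (algebraMap R S) := isLocalHom_toRingHom e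
  exact hR.of_flat (ringKrullDim_eq_of_ringEquiv e).ge

/-- Cohen–Macaulayness ascends along a flat algebra at a prime whose height does not exceed that
of its contraction. -/
lemma IsCohenMacaulayLocalRing.localization_of_flat {R S : Type*} [CommRing R] [CommRing S]
    [IsNoetherianRing S] [Algebra R S] [Module.Flat R S] (p : Ideal R) [p.IsPrime] (P : Ideal S)
    [P.IsPrime] [P.LiesOver p] (hp : IsCohenMacaulayLocalRing (Localization.AtPrime p))
    (hP : P.height ≤ p.height) : IsCohenMacaulayLocalRing (Localization.AtPrime P) := by
  let := Localization.AtPrime.algebraOfLiesOver p P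
  have : IsLocalHom (algebraMap (Localization.AtPrime p) (Localization.AtPrime P)) := by
    rw [Localization.AtPrime.IsLiesOverAlgebra.algebraMap_eq]
    infer_instance
  have : IsNoetherianRing (Localization.AtPrime P) :=
    IsLocalization.isNoetherianRing P.primeCompl _ ‹_›
  refine hp.of_flat ?_
  rw [IsLocalization.AtPrime.ringKrullDim_eq_height P,
    IsLocalization.AtPrime.ringKrullDim_eq_height p]
  exact_mod_cast hP

/-- A monic polynomial is a nonzerodivisor modulo an extended ideal. -/
lemma Polynomial.Monic.mem_map_C_of_mul_mem {R : Type*} [CommRing R] {f g : Polynomial R}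
    (hf : f.Monic) {I : Ideal R} (h : f * g ∈ I.map Polynomial.C) : g ∈ I.map Polynomial.C := by
  rw [← Ideal.mk_ker (I := I), ← Polynomial.ker_mapRingHom, RingHom.mem_ker] at h ⊢
  simpa [(hf.map (Ideal.Quotient.mk I)).mul_right_eq_zero_iff] using h

open RingTheory.Sequence Polynomial in
lemma IsCohenMacaulayLocalRing.polynomial {R : Type*} [CommRing R] [IsLocalRing R]
    [IsNoetherianRing R] (hR : IsCohenMacaulayLocalRing R) (P : Ideal R[X]) [P.IsPrime]
    (hP : P.comap Polynomial.C = IsLocalRing.maximalIdeal R) :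
    IsCohenMacaulayLocalRing (Localization.AtPrime P) := by
  have hPm : P.LiesOver (IsLocalRing.maximalIdeal R) := ⟨hP.symm⟩
  have : IsNoetherianRing (Localization.AtPrime P) :=
    IsLocalization.isNoetherianRing P.primeCompl _ inferInstance
  obtain ⟨rs, hmem, hreg, hlen⟩ := hR
  have hlen' : (IsLocalRing.maximalIdeal R).height = rs.length := by
    have := IsLocalRing.maximalIdeal_height_eq_ringKrullDim.trans hlen
    exact_mod_cast this
  have hmemP (r : R) (hr : r ∈ rs) : Polynomial.C r ∈ P := by
    rw [← Ideal.mem_comap, hP]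
    exact hmem r hr
  suffices H : ∃ ss : List R[X], (∀ s ∈ ss, s ∈ P) ∧ IsWeaklyRegular R[X] ss ∧
      P.height ≤ ss.length by
    obtain ⟨ss, hss, hreg, hht⟩ := H
    refine .of_isWeaklyRegular (ss.map (algebraMap _ (Localization.AtPrime P))) ?_ hreg.of_flat ?_
    · simp only [List.mem_map, forall_exists_index, and_imp, forall_apply_eq_imp_iff₂]
      exact fun s hs ↦ (IsLocalization.AtPrime.to_map_mem_maximal_iff _ P s).mpr (hss s hs)
    · rw [IsLocalization.AtPrime.ringKrullDim_eq_height P, List.length_map]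
      exact_mod_cast hht
  have hregC : IsWeaklyRegular R[X] (rs.map Polynomial.C) := hreg.1.of_flat
  have hmemC : ∀ s ∈ rs.map Polynomial.C, s ∈ P := by simpa using hmemP
  by_cases hPeq : P = (P.comap Polynomial.C).map Polynomial.C
  · refine ⟨rs.map Polynomial.C, hmemC, hregC, ?_⟩
    rw [hPeq, hP, height_map_C, hlen', List.length_map]
  · have hmax : (P.comap Polynomial.C).IsMaximal := by rw [hP]; infer_instance
    obtain ⟨f, hf, hPf⟩ := exists_monic_span_sup_map_eq R P hmax hPeq
    refine ⟨rs.map Polynomial.C ++ [f], ?_, ?_, ?_⟩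
    · simp only [List.mem_append, List.mem_singleton, or_imp, forall_and, forall_eq]
      refine ⟨hmemC, ?_⟩
      rw [hPf]
      exact Ideal.mem_sup_right (Ideal.mem_span_singleton_self f)
    · rw [isWeaklyRegular_append_iff, isWeaklyRegular_singleton_iff]
      refine ⟨hregC, ?_⟩
      rw [isSMulRegular_quotient_iff_mem_of_smul_mem]
      intro g hg
      rw [← Ideal.map_ofList] at hg ⊢
      simp only [smul_eq_mul, Ideal.mul_top] at hg ⊢
      exact hf.mem_map_C_of_mul_mem hg
    · set q := (IsLocalRing.maximalIdeal R).map (algebraMap R R[X])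
      have hqP : q ≤ P := by rw [Ideal.map_le_iff_le_comap, ← hP, Polynomial.algebraMap_eq]
      have hspan : P.map (Ideal.Quotient.mk q) = Ideal.span {Ideal.Quotient.mk q f} := by
        rw [hPf, hP, Ideal.map_sup, ← Polynomial.algebraMap_eq, Ideal.map_quotient_self,
          bot_sup_eq, Ideal.map_span, Set.image_singleton]
      have hprime : (P.map (Ideal.Quotient.mk q)).IsPrime :=
        Ideal.map_isPrime_of_surjective Ideal.Quotient.mk_surjective (by rwa [Ideal.mk_ker])
      have hbot : (P.map (Ideal.Quotient.mk q)).height ≤ 1 := by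
        rw [hspan]
        exact Ideal.height_span_singleton_le_one fun hu ↦
          hprime.ne_top (hspan.trans (Ideal.span_singleton_eq_top.mpr hu))
      refine (Ideal.height_le_height_add_of_liesOver (IsLocalRing.maximalIdeal R) P).trans ?_
      rw [hlen', List.length_append, List.length_map, List.length_singleton, Nat.cast_add,
        Nat.cast_one]
      gcongr

open Polynomial in
lemma IsCohenMacaulayRing.polynomial {R : Type*} [CommRing R] [IsNoetherianRing R]
    (hR : IsCohenMacaulayRing R) : IsCohenMacaulayRing R[X] := by
  rintro ⟨p, hp⟩
  let q := p.comap Polynomial.C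
  let S := (Localization.AtPrime q)[X]
  let M := Submonoid.map Polynomial.C.toMonoidHom q.primeCompl
  let : Algebra R[X] S := algebra R (Localization.AtPrime q)
  have : IsLocalization M S := Polynomial.isLocalization _ _
  let P := p.map (algebraMap R[X] S)
  have disj : Disjoint (M : Set R[X]) (p : Set R[X]) := by
    simpa [M, q] using! Set.disjoint_image_left.mpr
      (Set.disjoint_compl_left_iff_subset.mpr (fun _ a ↦ a))
  have : P.IsPrime := IsLocalization.isPrime_of_isPrime_disjoint M _ _ ‹_› disj
  have : IsLocalization.AtPrime (Localization.AtPrime P) p := by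
    convert IsLocalization.isLocalization_isLocalization_atPrime_isLocalization M
      (Localization.AtPrime P) P
    exact (IsLocalization.under_map_of_isPrime_disjoint M _ ‹_› disj).symm
  have hP : Ideal.comap Polynomial.C P = IsLocalRing.maximalIdeal (Localization.AtPrime q) := by
    rw [← IsLocalization.map_under q.primeCompl _ (Ideal.comap Polynomial.C P),
      ← IsLocalization.map_under q.primeCompl _ (IsLocalRing.maximalIdeal (Localization.AtPrime q))]
    simp only [Ideal.comap_comap, S, P]
    rw [← Polynomial.algebraMap_eq (R := Localization.AtPrime q),
      ← IsScalarTower.algebraMap_eq R (Localization.AtPrime q) (Localization.AtPrime q)[X],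
      IsScalarTower.algebraMap_eq R R[X] (Localization.AtPrime q)[X], ← Ideal.comap_comap,
      ← Ideal.under_def R[X], IsLocalization.under_map_of_isPrime_disjoint M _ ‹_› disj]
    simp [q, IsLocalization.AtPrime.under_maximalIdeal (Localization.AtPrime q) q]
  exact ((hR ⟨q, inferInstance⟩).polynomial P hP).of_ringEquiv (IsLocalization.algEquiv p.primeCompl
    (Localization.AtPrime P) (Localization.AtPrime p)).toRingEquiv

lemma IsCohenMacaulayRing.of_ringEquiv {R S : Type*} [CommRing R] [CommRing S]
    [IsNoetherianRing S] (e : R ≃+* S) (hR : IsCohenMacaulayRing R) : IsCohenMacaulayRing S := by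
  rintro ⟨P, hP⟩
  algebraize [e.toRingHom]
  have : Module.Flat R S :=
    .of_linearEquiv (AlgEquiv.ofRingEquiv (f := e) fun _ ↦ rfl).symm.toLinearEquiv
  exact .localization_of_flat (P.under R) P (hR ⟨P.under R, inferInstance⟩) (e.height_comap P).ge

lemma IsCohenMacaulayRing.of_field {k : Type*} [Field k] : IsCohenMacaulayRing k := by
  rintro ⟨p, hp⟩
  have : IsNoetherianRing (Localization.AtPrime p) :=
    IsLocalization.isNoetherianRing p.primeCompl _ inferInstance
  refine .of_isWeaklyRegular [] (by simp) (.nil _ _) ?_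
  rw [IsLocalization.AtPrime.ringKrullDim_eq_height p]
  exact Ideal.height_le_ringKrullDim_of_isPrime.trans (ringKrullDim_eq_zero_of_field k).le

lemma IsCohenMacaulayRing.mvPolynomial {k : Type*} [Field k] (n : ℕ) :
    IsCohenMacaulayRing (MvPolynomial (Fin n) k) := by
  induction n with
  | zero => exact .of_ringEquiv (MvPolynomial.isEmptyRingEquiv k (Fin 0)).symm .of_field
  | succ n ih => exact ih.polynomial.of_ringEquiv (MvPolynomial.finSuccEquiv k n).symm.toRingEquiv

/-- Contraction along an integral extension does not lower heights. -/
lemma Ideal.height_le_height_under_of_isIntegral {R S : Type*} [CommRing R] [CommRing S]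
    [Algebra R S] [Algebra.IsIntegral R S] (P : Ideal S) [hP : P.IsPrime] :
    P.height ≤ (P.under R).height := by
  have hmono : StrictMono (PrimeSpectrum.comap (algebraMap R S)) :=
    fun _ _ h ↦ Ideal.IsIntegral.comap_lt_comap h
  rw [(⟨P, hP⟩ : PrimeSpectrum S).height_eq_orderHeight,
    (⟨P.under R, inferInstance⟩ : PrimeSpectrum R).height_eq_orderHeight]
  exact Order.height_le_height_apply_of_strictMono _ hmono _

lemma Ideal.height_le_height_under_of_isIntegral_of_isLocalization {R S T : Type*} [CommRing R]
    [CommRing S] [CommRing T] [Algebra R S] [Algebra S T] [Algebra R T] [IsScalarTower R S T]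
    [Algebra.IsIntegral R S] (M : Submonoid S) [IsLocalization M T] (P : Ideal T) [P.IsPrime] :
    P.height ≤ (P.under R).height := by
  have h := (P.under S).height_le_height_under_of_isIntegral (R := R)
  rwa [IsLocalization.height_under M P, Ideal.under_under] at h

/-- A localization of an integral flat algebra over a Cohen–Macaulay ring is Cohen–Macaulay. -/
lemma IsCohenMacaulayRing.of_isIntegral_of_isLocalization {R S T : Type*} [CommRing R] [CommRing S]
    [CommRing T] [IsNoetherianRing T] [Algebra R S] [Algebra S T] [Algebra R T]
    [IsScalarTower R S T] [Module.Flat R S] [Algebra.IsIntegral R S] (M : Submonoid S)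
    [IsLocalization M T] (hR : IsCohenMacaulayRing R) : IsCohenMacaulayRing T := by
  rintro ⟨P, hP⟩
  have : Module.Flat S T := IsLocalization.flat T M
  have : Module.Flat R T := .trans R S T
  refine .localization_of_flat (P.under R) P (hR ⟨P.under R, inferInstance⟩) ?_
  exact Ideal.height_le_height_under_of_isIntegral_of_isLocalization M P

/-- The ideal `(A, B, C, D)` of the polynomial ring. -/
noncomputable def polyIone (k : Type*) [CommRing k] : Ideal (MvPolynomial (Fin 8) k) :=
  Ideal.span {X 0, X 1, X 2, X 3}

/-- The ideal `(A² + BC, CQ + BR, T, A + D)` of the polynomial ring. -/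
noncomputable def polyIN (k : Type*) [CommRing k] : Ideal (MvPolynomial (Fin 8) k) :=
  Ideal.span {X 0 ^ 2 + X 1 * X 2, X 2 * X 5 + X 1 * X 6, X 7, X 0 + X 3}

/-- The ideal `(A + D, AT, BT, CT, A² + BC, BR + CQ)` of the polynomial ring. -/
noncomputable def polyJ (k : Type*) [CommRing k] : Ideal (MvPolynomial (Fin 8) k) :=
  Ideal.span {X 0 + X 3, X 0 * X 7, X 1 * X 7, X 2 * X 7, X 0 ^ 2 + X 1 * X 2,
    X 1 * X 6 + X 2 * X 5}

/-- The substitution `A, B, C, D ↦ 0`. -/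
noncomputable def substZero (k : Type*) [CommRing k] :
    MvPolynomial (Fin 8) k →ₐ[k] MvPolynomial (Fin 8) k :=
  aeval ![0, 0, 0, 0, X 4, X 5, X 6, X 7]

lemma mem_polyIone_iff {k : Type*} [CommRing k] {x : MvPolynomial (Fin 8) k} :
    x ∈ polyIone k ↔ substZero k x = 0 := by
  constructor
  · intro hx
    rw [← RingHom.mem_ker]
    refine (Ideal.span_le.mpr ?_ : polyIone k ≤ RingHom.ker (substZero k)) hx
    simp [Set.insert_subset_iff, substZero, RingHom.mem_ker]
  · intro hx
    have h : (Ideal.Quotient.mkₐ k (polyIone k)).comp (substZero k) =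
        Ideal.Quotient.mkₐ k (polyIone k) := by
      ext i
      have hi : ∀ x ∈ ({X 0, X 1, X 2, X 3} : Set (MvPolynomial (Fin 8) k)),
          Ideal.Quotient.mk (polyIone k) x = 0 := fun x hx ↦
        Ideal.Quotient.eq_zero_iff_mem.mpr (Ideal.subset_span hx)
      simp only [Set.mem_insert_iff, Set.mem_singleton_iff, forall_eq_or_imp, forall_eq] at hi
      fin_cases i <;> simp [substZero, hi]
    have := congr($h x)
    rw [AlgHom.comp_apply, hx, map_zero] at this
    exact Ideal.Quotient.eq_zero_iff_mem.mp this.symm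

lemma mem_polyIone_of_mul_X_seven_mem {k : Type*} [CommRing k] [IsDomain k]
    {c : MvPolynomial (Fin 8) k} (h : c * X 7 ∈ polyIone k) : c ∈ polyIone k := by
  rw [mem_polyIone_iff] at h ⊢
  rw [map_mul] at h
  refine (mul_eq_zero.mp h).resolve_right ?_
  simp [substZero]

lemma polyIone_inf_polyIN (k : Type*) [CommRing k] [IsDomain k] :
    polyIone k ⊓ polyIN k = polyJ k := by
  apply le_antisymm
  · rintro x ⟨hx1, hxN⟩
    simp only [polyIN, SetLike.mem_coe, Ideal.mem_span_insert, Ideal.mem_span_singleton'] at hxN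
    obtain ⟨a, _, ⟨b, _, ⟨c, _, ⟨d, rfl⟩, rfl⟩, rfl⟩, rfl⟩ := hxN
    have hJ : ∀ x ∈ ({X 0 + X 3, X 0 * X 7, X 1 * X 7, X 2 * X 7, X 0 ^ 2 + X 1 * X 2,
        X 1 * X 6 + X 2 * X 5} : Set (MvPolynomial (Fin 8) k)), x ∈ polyJ k :=
      fun x hx ↦ Ideal.subset_span hx
    simp only [Set.mem_insert_iff, Set.mem_singleton_iff, forall_eq_or_imp, forall_eq] at hJ
    obtain ⟨h1, h2, h3, h4, h5, h6⟩ := hJ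
    have hc : c ∈ polyIone k := by
      apply mem_polyIone_of_mul_X_seven_mem
      rw [SetLike.mem_coe, mem_polyIone_iff] at hx1
      rw [mem_polyIone_iff]
      simpa [substZero] using hx1
    have hcT : c * X 7 ∈ polyJ k := by
      simp only [polyIone, Ideal.mem_span_insert, Ideal.mem_span_singleton'] at hc
      obtain ⟨u, _, ⟨v, _, ⟨w, _, ⟨z, rfl⟩, rfl⟩, rfl⟩, rfl⟩ := hc
      have h7 : X 3 * X 7 ∈ polyJ k := by
        convert (polyJ k).sub_mem ((polyJ k).mul_mem_right (X 7) h1) h2 using 1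
        ring
      convert add_mem (add_mem (add_mem ((polyJ k).mul_mem_left u h2)
        ((polyJ k).mul_mem_left v h3)) ((polyJ k).mul_mem_left w h4))
        ((polyJ k).mul_mem_left z h7) using 1
      ring
    refine add_mem (Ideal.mul_mem_left _ _ h5) (add_mem (Ideal.mul_mem_left _ _ ?_)
      (add_mem hcT (Ideal.mul_mem_left _ _ h1)))
    rwa [add_comm]
  · refine le_inf ?_ (Ideal.span_le.mpr ?_)
    · intro x hx
      rw [mem_polyIone_iff, ← RingHom.mem_ker]
      refine (Ideal.span_le.mpr ?_ : polyJ k ≤ RingHom.ker (substZero k)) hx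
      simp [Set.insert_subset_iff, substZero, RingHom.mem_ker]
    · have hN : ∀ x ∈ ({X 0 ^ 2 + X 1 * X 2, X 2 * X 5 + X 1 * X 6, X 7, X 0 + X 3} :
          Set (MvPolynomial (Fin 8) k)), x ∈ polyIN k := fun x hx ↦ Ideal.subset_span hx
      simp only [Set.mem_insert_iff, Set.mem_singleton_iff, forall_eq_or_imp, forall_eq] at hN
      simp only [Set.insert_subset_iff, Set.singleton_subset_iff, SetLike.mem_coe]
      refine ⟨hN.2.2.2, Ideal.mul_mem_left _ _ hN.2.2.1, Ideal.mul_mem_left _ _ hN.2.2.1,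
        Ideal.mul_mem_left _ _ hN.2.2.1, hN.1, ?_⟩
      rw [add_comm]
      exact hN.2.1

lemma polyIone_sup_polyIN (k : Type*) [CommRing k] :
    polyIone k ⊔ polyIN k = Ideal.span {X 0, X 1, X 2, X 3, X 7} := by
  have hm : ∀ x ∈ ({X 0, X 1, X 2, X 3, X 7} : Set (MvPolynomial (Fin 8) k)),
      x ∈ Ideal.span ({X 0, X 1, X 2, X 3, X 7} : Set (MvPolynomial (Fin 8) k)) :=
    fun x hx ↦ Ideal.subset_span hx
  have h1 : ∀ x ∈ ({X 0, X 1, X 2, X 3} : Set (MvPolynomial (Fin 8) k)), x ∈ polyIone k :=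
    fun x hx ↦ Ideal.subset_span hx
  have h7 : X 7 ∈ polyIN k := Ideal.subset_span (by simp)
  simp only [Set.mem_insert_iff, Set.mem_singleton_iff, forall_eq_or_imp, forall_eq] at hm h1
  obtain ⟨m0, m1, m2, m3, m7⟩ := hm
  refine le_antisymm (sup_le (Ideal.span_mono ?_) (Ideal.span_le.mpr ?_)) (Ideal.span_le.mpr ?_)
  · simp [Set.insert_subset_iff]
  · simp only [Set.insert_subset_iff, Set.singleton_subset_iff, SetLike.mem_coe]
    exact ⟨add_mem (Ideal.pow_mem_of_mem _ m0 2 two_pos) (Ideal.mul_mem_right _ _ m1),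
      add_mem (Ideal.mul_mem_right _ _ m2) (Ideal.mul_mem_right _ _ m1), m7, add_mem m0 m3⟩
  · simp only [Set.insert_subset_iff, Set.singleton_subset_iff, SetLike.mem_coe]
    exact ⟨Ideal.mem_sup_left h1.1, Ideal.mem_sup_left h1.2.1, Ideal.mem_sup_left h1.2.2.1,
      Ideal.mem_sup_left h1.2.2.2, Ideal.mem_sup_right h7⟩

lemma Ione_eq_map (k : Type*) [CommRing k] :
    Ione k = (polyIone k).map (algebraMap _ (Sbar k)) := by
  simp [Ione, polyIone, toSbar, Ideal.map_span, Set.image_insert_eq]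

lemma IN_eq_map (k : Type*) [CommRing k] : IN k = (polyIN k).map (algebraMap _ (Sbar k)) := by
  simp [IN, polyIN, toSbar, Ideal.map_span, Set.image_insert_eq]

lemma Ione_inf_IN_eq_map (k : Type*) [CommRing k] [IsDomain k] :
    Ione k ⊓ IN k = (polyJ k).map (algebraMap _ (Sbar k)) := by
  rw [Ione_eq_map, IN_eq_map, ← polyIone_inf_polyIN,
    IsLocalization.map_inf (Submonoid.closure {detSigma k, detPhi k})]

lemma Ione_inf_IN (k : Type*) [CommRing k] [IsDomain k] :
    Ione k ⊓ IN k = Ideal.span {toSbar k (X 0 + X 3), toSbar k (X 0 * X 7),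
      toSbar k (X 1 * X 7), toSbar k (X 2 * X 7), toSbar k (X 0 ^ 2 + X 1 * X 2),
      toSbar k (X 1 * X 6 + X 2 * X 5)} := by
  rw [Ione_inf_IN_eq_map]
  simp [polyJ, toSbar, Ideal.map_span, Set.image_insert_eq]

lemma Ione_sup_IN (k : Type*) [CommRing k] :
    Ione k ⊔ IN k = Ideal.span {toSbar k (X 0), toSbar k (X 1), toSbar k (X 2),
      toSbar k (X 3), toSbar k (X 7)} := by
  rw [Ione_eq_map, IN_eq_map, ← Ideal.map_sup, polyIone_sup_polyIN]
  simp [toSbar, Ideal.map_span, Set.image_insert_eq]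

/-- The parametrization `P, Q, U, V ↦ P, Q, B + R, C + T`. -/
noncomputable def paramHom (k : Type*) [CommRing k] :
    MvPolynomial (Fin 4) k →ₐ[k] MvPolynomial (Fin 8) k :=
  aeval ![X 4, X 5, X 1 + X 6, X 2 + X 7]

noncomputable instance (k : Type*) [CommRing k] :
    Algebra (MvPolynomial (Fin 4) k) (MvPolynomial (Fin 8) k) :=
  (paramHom k).toRingHom.toAlgebra

lemma smul_quotient_polyJ {k : Type*} [CommRing k] (p : MvPolynomial (Fin 4) k)
    (y : MvPolynomial (Fin 8) k ⧸ polyJ k) :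
    p • y = Ideal.Quotient.mk (polyJ k) (paramHom k p) * y :=
  Algebra.smul_def p y

/-- The family `1, A, B, C, AB` in `k[A, …, T] ⧸ (I₁ ∩ I_N)`. -/
noncomputable def quotFamily (k : Type*) [CommRing k] :
    Fin 5 → MvPolynomial (Fin 8) k ⧸ polyJ k :=
  fun i ↦ Ideal.Quotient.mk (polyJ k) (![1, X 0, X 1, X 2, X 0 * X 1] i)

lemma span_quotFamily (k : Type*) [CommRing k] :
    Submodule.span (MvPolynomial (Fin 4) k) (Set.range (quotFamily k)) = ⊤ := by
  set N := Submodule.span (MvPolynomial (Fin 4) k) (Set.range (quotFamily k)) with hN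
  set π := Ideal.Quotient.mk (polyJ k) with hπ
  have hv (i : Fin 5) : quotFamily k i ∈ N := Submodule.subset_span ⟨i, rfl⟩
  have v0 : quotFamily k 0 = π 1 := rfl
  have v1 : quotFamily k 1 = π (X 0) := rfl
  have v2 : quotFamily k 2 = π (X 1) := rfl
  have v3 : quotFamily k 3 = π (X 2) := rfl
  have v4 : quotFamily k 4 = π (X 0) * π (X 1) := map_mul _ _ _
  have hJ : ∀ x ∈ ({X 0 + X 3, X 0 * X 7, X 1 * X 7, X 2 * X 7, X 0 ^ 2 + X 1 * X 2,
      X 1 * X 6 + X 2 * X 5} : Set (MvPolynomial (Fin 8) k)), π x = 0 :=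
    fun x hx ↦ Ideal.Quotient.eq_zero_iff_mem.mpr (Ideal.subset_span hx)
  simp only [Set.mem_insert_iff, Set.mem_singleton_iff, forall_eq_or_imp, forall_eq, map_add,
    map_mul, map_pow] at hJ
  obtain ⟨e1, e2, e3, e4, e5, e6⟩ := hJ
  have hq (y : MvPolynomial (Fin 8) k ⧸ polyJ k) :
      (X 1 : MvPolynomial (Fin 4) k) • y = π (X 5) * y := by
    simp [smul_quotient_polyJ, paramHom, hπ]
  have hp (y : MvPolynomial (Fin 8) k ⧸ polyJ k) :
      (X 0 : MvPolynomial (Fin 4) k) • y = π (X 4) * y := by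
    simp [smul_quotient_polyJ, paramHom, hπ]
  have hu (y : MvPolynomial (Fin 8) k ⧸ polyJ k) :
      (X 2 : MvPolynomial (Fin 4) k) • y = (π (X 1) + π (X 6)) * y := by
    simp [smul_quotient_polyJ, paramHom, hπ]
  have hw (y : MvPolynomial (Fin 8) k ⧸ polyJ k) :
      (X 3 : MvPolynomial (Fin 4) k) • y = (π (X 2) + π (X 7)) * y := by
    simp [smul_quotient_polyJ, paramHom, hπ]
  have key (x : MvPolynomial (Fin 8) k ⧸ polyJ k) (hx : ∀ i, x * quotFamily k i ∈ N)
      (n) (hn : n ∈ N) : x * n ∈ N := by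
    refine (Submodule.span_le.mpr ?_ :
      N ≤ N.comap (LinearMap.mulLeft (MvPolynomial (Fin 4) k) x)) hn
    rintro _ ⟨i, rfl⟩
    exact hx i
  have ha := key (π (X 0)) fun i ↦ by
    fin_cases i
    · exact (mul_one (π (X 0))).symm ▸ hv 1
    · convert N.smul_mem (-X 3) (hv 2) using 1
      simp only [neg_smul, hw, Fin.reduceFinMk, v1, v2]
      linear_combination e5 + e3
    · exact v4 ▸ hv 4
    · convert N.smul_mem (X 3) (hv 1) using 1
      simp only [hw, Fin.reduceFinMk, v1, v3]
      linear_combination -e2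
    · convert N.sub_mem (N.smul_mem (-X 3) (N.smul_mem (X 2) (hv 2)))
        (N.smul_mem (X 3) (N.smul_mem (X 1) (hv 3))) using 1
      simp only [neg_smul, hw, hu, hq, Fin.reduceFinMk, v4, v2, v3]
      linear_combination e5 * π (X 1) + π (X 2) * e6 + (π (X 1) + π (X 6)) * e3 + π (X 5) * e4
  have hb := key (π (X 1)) fun i ↦ by
    fin_cases i
    · exact (mul_one (π (X 1))).symm ▸ hv 2
    · exact (mul_comm (π (X 1)) (π (X 0))) ▸ v4 ▸ hv 4
    · convert N.add_mem (N.smul_mem (X 2) (hv 2)) (N.smul_mem (X 1) (hv 3)) using 1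
      simp only [hu, hq, Fin.reduceFinMk, v2, v3]
      linear_combination -e6
    · convert N.smul_mem (X 3) (hv 2) using 1
      simp only [hw, Fin.reduceFinMk, v2, v3]
      linear_combination -e3
    · convert N.add_mem (N.smul_mem (X 2) (hv 4))
        (N.smul_mem (X 1) (N.smul_mem (X 3) (hv 1))) using 1
      simp only [hw, hu, hq, Fin.reduceFinMk, v4, v1]
      linear_combination -π (X 0) * e6 - π (X 5) * e2
  have hc := key (π (X 2)) fun i ↦ by
    fin_cases i
    · exact (mul_one (π (X 2))).symm ▸ hv 3
    · convert N.smul_mem (X 3) (hv 1) using 1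
      simp only [hw, Fin.reduceFinMk, v1]
      linear_combination -e2
    · convert N.smul_mem (X 3) (hv 2) using 1
      simp only [hw, Fin.reduceFinMk, v2]
      linear_combination -e3
    · convert N.smul_mem (X 3) (hv 3) using 1
      simp only [hw, Fin.reduceFinMk, v3]
      linear_combination -e4
    · convert N.smul_mem (X 3) (hv 4) using 1
      simp only [hw, Fin.reduceFinMk, v4]
      linear_combination -π (X 1) * e2
  have hX (i : Fin 8) (n) (hn : n ∈ N) : π (X i) * n ∈ N := by
    fin_cases i
    · exact ha n hn
    · exact hb n hn
    · exact hc n hn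
    · convert N.neg_mem (ha n hn) using 1
      simp only [Fin.reduceFinMk]
      linear_combination n * e1
    · exact hp n ▸ N.smul_mem _ hn
    · exact hq n ▸ N.smul_mem _ hn
    · convert N.sub_mem (N.smul_mem (X 2) hn) (hb n hn) using 1
      simp only [hu, Fin.reduceFinMk]
      ring
    · convert N.sub_mem (N.smul_mem (X 3) hn) (hc n hn) using 1
      simp only [hw, Fin.reduceFinMk]
      ring
  have hall (p : MvPolynomial (Fin 8) k) : ∀ n ∈ N, π p * n ∈ N := by
    induction p using MvPolynomial.induction_on with
    | C c =>
      intro n hn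
      convert N.smul_mem (C c) hn using 1
      simp [smul_quotient_polyJ, paramHom, hπ, algebraMap_eq]
    | add p q hp hq =>
      intro n hn
      rw [map_add, add_mul]
      exact N.add_mem (hp n hn) (hq n hn)
    | mul_X p i hp =>
      intro n hn
      rw [map_mul, mul_assoc]
      exact hp _ (hX i n hn)
  refine Submodule.eq_top_iff'.mpr fun y ↦ ?_
  obtain ⟨p, rfl⟩ := Ideal.Quotient.mk_surjective y
  have := hall p _ (hv 0)
  rwa [v0, map_one, mul_one] at this

/-- The monic quadratic polynomial `X² - (x X + y)`. -/
noncomputable def monicQuadratic {R : Type*} [CommRing R] (x y : R) : Polynomial R :=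
  Polynomial.X ^ 2 - (Polynomial.C x * Polynomial.X + Polynomial.C y)

lemma root_monicQuadratic_sq {R : Type*} [CommRing R] (x y : R) :
    AdjoinRoot.root (monicQuadratic x y) ^ 2 =
      AdjoinRoot.of _ x * AdjoinRoot.root (monicQuadratic x y) + AdjoinRoot.of _ y := by
  have h : AdjoinRoot.mk (monicQuadratic x y)
      (Polynomial.X ^ 2 - (Polynomial.C x * Polynomial.X + Polynomial.C y)) = 0 :=
    AdjoinRoot.mk_self
  simpa [sub_eq_zero] using h

lemma eq_zero_of_add_mul_root_monicQuadratic_eq_zero {R : Type*} [CommRing R] [Nontrivial R]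
    {u v x y : R} (h : AdjoinRoot.of (monicQuadratic u v) x +
      AdjoinRoot.of (monicQuadratic u v) y * AdjoinRoot.root (monicQuadratic u v) = 0) :
    x = 0 ∧ y = 0 := by
  have hf : (monicQuadratic u v).Monic :=
    Polynomial.monic_X_pow_sub (Polynomial.degree_linear_le.trans_lt (by norm_num))
  have hdeg : (monicQuadratic u v).natDegree = 2 := by
    rw [monicQuadratic]
    compute_degree!
  have h' : AdjoinRoot.mk (monicQuadratic u v)
      (Polynomial.C y * Polynomial.X + Polynomial.C x) = 0 := by
    rw [map_add, map_mul, AdjoinRoot.mk_C, AdjoinRoot.mk_C, AdjoinRoot.mk_X, add_comm, h]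
  rw [AdjoinRoot.mk_eq_zero] at h'
  have h0 : Polynomial.C y * Polynomial.X + Polynomial.C x = 0 := by
    by_contra hne
    refine hf.not_dvd_of_natDegree_lt hne ?_ h'
    exact hdeg ▸ Polynomial.natDegree_linear_le.trans_lt one_lt_two
  exact ⟨by simpa using congr(Polynomial.coeff $h0 0), by simpa using congr(Polynomial.coeff $h0 1)⟩

instance {R : Type*} [CommRing R] [Nontrivial R] (x y : R) :
    Nontrivial (AdjoinRoot (monicQuadratic x y)) := by
  refine nontrivial_of_ne 1 0 fun h ↦ one_ne_zero (α := R) ?_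
  refine (eq_zero_of_add_mul_root_monicQuadratic_eq_zero (u := x) (v := y) (y := 0) ?_).1
  rw [map_one, h, map_zero, zero_mul, add_zero]

lemma linearIndependent_quotFamily (k : Type*) [Field k] :
    LinearIndependent (MvPolynomial (Fin 4) k) (quotFamily k) := by
  let R := MvPolynomial (Fin 4) k
  let R' := AdjoinRoot (monicQuadratic (X 2 : R) (X 1 * X 3))
  let β : R' := AdjoinRoot.root _
  let S := AdjoinRoot (monicQuadratic (0 : R') (-(AdjoinRoot.of _ (X 3) * β)))
  let α : S := AdjoinRoot.root _
  let j : R →+* S := (AdjoinRoot.of _).comp (AdjoinRoot.of _)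
  let β' : S := AdjoinRoot.of _ β
  have hβ : β' ^ 2 = j (X 2) * β' + j (X 1) * j (X 3) := by
    have := congr(AdjoinRoot.of (monicQuadratic (0 : R') (-(AdjoinRoot.of _ (X 3) * β)))
      $(root_monicQuadratic_sq (X 2 : R) (X 1 * X 3)))
    simp only [map_add, map_mul, map_pow] at this
    exact this
  have hα : α ^ 2 = -(j (X 3) * β') := by
    have := root_monicQuadratic_sq (0 : R') (-(AdjoinRoot.of _ (X 3) * β))
    simp only [map_neg, map_mul, map_zero, zero_mul, zero_add] at this
    exact this
  let φ : MvPolynomial (Fin 8) k →+* S :=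
    eval₂Hom (j.comp C) ![α, β', j (X 3), -α, j (X 0), j (X 1), j (X 2) - β', 0]
  have hφ : ∀ x ∈ polyJ k, φ x = 0 := by
    intro x hx
    refine (Ideal.span_le.mpr ?_ : polyJ k ≤ RingHom.ker φ) hx
    simp only [Set.insert_subset_iff, Set.singleton_subset_iff, SetLike.mem_coe, RingHom.mem_ker]
    refine ⟨by simp [φ], by simp [φ], by simp [φ], by simp [φ], ?_, ?_⟩
    · simp [φ]
      linear_combination hα
    · simp [φ]
      linear_combination -hβ
  have hφj (p : R) : φ (paramHom k p) = j p := by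
    suffices φ.comp (paramHom k).toRingHom = j from congr($this p)
    refine MvPolynomial.ringHom_ext (fun c ↦ ?_) fun i ↦ ?_
    · simp [φ, paramHom, algebraMap_eq]
    · fin_cases i <;> simp [φ, paramHom]
  let ψ : MvPolynomial (Fin 8) k →ₐ[k] R := aeval ![0, 0, 0, 0, X 0, X 1, X 2, X 3]
  have hψ : ∀ x ∈ polyJ k, ψ x = 0 := by
    intro x hx
    refine (Ideal.span_le.mpr ?_ : polyJ k ≤ RingHom.ker ψ) hx
    simp [Set.insert_subset_iff, ψ, RingHom.mem_ker]
  have hψj (p : R) : ψ (paramHom k p) = p := by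
    suffices ψ.comp (paramHom k) = AlgHom.id k R from congr($this p)
    ext i : 1
    fin_cases i <;> simp [ψ, paramHom, R]
  rw [Fintype.linearIndependent_iff]
  intro c hc
  have hc' : paramHom k (c 0) + paramHom k (c 1) * X 0 + paramHom k (c 2) * X 1 +
      paramHom k (c 3) * X 2 + paramHom k (c 4) * (X 0 * X 1) ∈ polyJ k := by
    rw [← Ideal.Quotient.eq_zero_iff_mem, ← hc]
    simp [Fin.sum_univ_five, quotFamily, smul_quotient_polyJ]
  have h0 : c 0 = 0 := by
    have := hψ _ hc'
    simp only [map_add, map_mul, hψj] at this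
    simpa [ψ] using this
  have h1 := hφ _ hc'
  simp only [map_add, map_mul, hφj] at h1
  have h2 : AdjoinRoot.of _ (AdjoinRoot.of _ (c 3 * X 3) + AdjoinRoot.of _ (c 2) * β) +
      AdjoinRoot.of _ (AdjoinRoot.of _ (c 1) + AdjoinRoot.of _ (c 4) * β) * α = 0 := by
    rw [← h1]
    simp [φ, h0, j, β']
    ring
  obtain ⟨h3, h4⟩ := eq_zero_of_add_mul_root_monicQuadratic_eq_zero h2
  obtain ⟨h5, h6⟩ := eq_zero_of_add_mul_root_monicQuadratic_eq_zero h3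
  obtain ⟨h7, h8⟩ := eq_zero_of_add_mul_root_monicQuadratic_eq_zero h4
  have h9 : c 3 = 0 := (mul_eq_zero.mp h5).resolve_right (X_ne_zero 3)
  intro i
  fin_cases i <;> assumption

instance (k : Type*) [Field k] :
    Module.Free (MvPolynomial (Fin 4) k) (MvPolynomial (Fin 8) k ⧸ polyJ k) :=
  .of_basis (.mk (linearIndependent_quotFamily k) (span_quotFamily k).ge)

instance (k : Type*) [CommRing k] :
    Module.Finite (MvPolynomial (Fin 4) k) (MvPolynomial (Fin 8) k ⧸ polyJ k) :=
  .of_fg_top (span_quotFamily k ▸ Submodule.fg_span (Set.finite_range _))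

lemma ringKrullDim_le_of_isIntegral_of_isLocalization {R S T : Type*} [CommRing R]
    [CommRing S] [CommRing T] [Algebra R S] [Algebra S T] [Algebra R T] [IsScalarTower R S T]
    [Algebra.IsIntegral R S] (M : Submonoid S) [IsLocalization M T] :
    ringKrullDim T ≤ ringKrullDim R := by
  rw [ringKrullDim_le_iff_height_le]
  intro P hP
  exact (WithBot.coe_le_coe.mpr
    (Ideal.height_le_height_under_of_isIntegral_of_isLocalization (R := R) M P)).trans
    Ideal.height_le_ringKrullDim_of_isPrime

lemma Ideal.height_ker_add_one_le {R A B : Type*} [CommRing R] [CommRing A] [IsDomain A]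
    [CommRing B] [IsDomain B] (f : R →+* A) (g : A →+* B) {x : R} (hf : f x ≠ 0)
    (hg : g (f x) = 0) : (RingHom.ker f).height + 1 ≤ (RingHom.ker (g.comp f)).height := by
  have := RingHom.ker_isPrime f
  have := RingHom.ker_isPrime (g.comp f)
  refine Ideal.height_add_one_le_of_lt_of_isPrime
    (lt_of_le_of_ne (fun y hy ↦ ?_) fun h ↦ hf (RingHom.mem_ker.mp (h ▸ hg)))
  rw [RingHom.mem_ker] at hy ⊢
  rw [RingHom.comp_apply, hy, map_zero]

/-- The point `P = 1`, `Q = U = V = 0` of affine `4`-space has codimension at least `4`. -/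
lemma four_le_height_ker {k B : Type*} [Field k] [CommRing B] [IsDomain B]
    (ε : MvPolynomial (Fin 4) k →+* B) (h0 : ε (X 0) = 1) (h1 : ε (X 1) = 0) (h2 : ε (X 2) = 0)
    (h3 : ε (X 3) = 0) : 4 ≤ (RingHom.ker ε).height := by
  let g (v : Fin 4 → MvPolynomial (Fin 4) k) : MvPolynomial (Fin 4) k →+* MvPolynomial (Fin 4) k :=
    eval₂Hom C v
  let g₀ := g ![1, X 1, X 2, X 3]
  let g₁ := g ![X 0, 0, X 2, X 3]
  let g₂ := g ![X 0, X 1, 0, X 3]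
  let g₃ := g ![X 0, X 1, X 2, 0]
  have e₀ := Ideal.height_ker_add_one_le (RingHom.id (MvPolynomial (Fin 4) k)) g₀ (x := X 0 - 1)
    (sub_ne_zero.mpr fun h ↦ by simpa using congr(constantCoeff $h)) (by simp [g, g₀])
  have e₁ := Ideal.height_ker_add_one_le (g₀.comp (.id _)) g₁ (x := X 1)
    (by simp [g, g₀]) (by simp [g, g₀, g₁])
  have e₂ := Ideal.height_ker_add_one_le (g₁.comp (g₀.comp (.id _))) g₂ (x := X 2)
    (by simp [g, g₀, g₁]) (by simp [g, g₀, g₁, g₂])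
  have e₃ := Ideal.height_ker_add_one_le (g₂.comp (g₁.comp (g₀.comp (.id _)))) g₃ (x := X 3)
    (by simp [g, g₀, g₁, g₂]) (by simp [g, g₀, g₁, g₂, g₃])
  have hε : ε.comp (g₃.comp (g₂.comp (g₁.comp (g₀.comp (.id _))))) = ε := by
    refine MvPolynomial.ringHom_ext (fun c ↦ ?_) fun i ↦ ?_
    · simp [g, g₀, g₁, g₂, g₃]
    · fin_cases i <;> simp [g, g₀, g₁, g₂, g₃, h0, h1, h2, h3]
  have hle : RingHom.ker (g₃.comp (g₂.comp (g₁.comp (g₀.comp (.id _))))) ≤ RingHom.ker ε := by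
    intro x hx
    rw [RingHom.mem_ker] at hx ⊢
    rw [← hε, RingHom.comp_apply, hx, map_zero]
  refine le_trans ?_ (Ideal.height_mono hle)
  calc (4 : ℕ∞) = 0 + 1 + 1 + 1 + 1 := by norm_num
    _ ≤ _ := by
      refine le_trans ?_ e₃
      gcongr
      refine le_trans ?_ e₂
      gcongr
      refine le_trans ?_ e₁
      gcongr
      refine le_trans ?_ e₀
      gcongr
      exact zero_le

/-- The quotient of `S̄` by the extension of `polyJ`. -/
abbrev SbarQuot (k : Type*) [CommRing k] :=
  Sbar k ⧸ (polyJ k).map (algebraMap _ (Sbar k))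

instance (k : Type*) [CommRing k] : IsScalarTower (MvPolynomial (Fin 4) k)
    (MvPolynomial (Fin 8) k ⧸ polyJ k) (SbarQuot k) :=
  IsScalarTower.of_algebraMap_eq (R := MvPolynomial (Fin 4) k)
    (S := MvPolynomial (Fin 8) k ⧸ polyJ k) (A := SbarQuot k) fun _ ↦ rfl

instance (k : Type*) [Field k] : Module.Flat (MvPolynomial (Fin 4) k) (SbarQuot k) :=
  have : Module.Flat (MvPolynomial (Fin 8) k ⧸ polyJ k) (SbarQuot k) :=
    IsLocalization.flat _ (Algebra.algebraMapSubmonoid (MvPolynomial (Fin 8) k ⧸ polyJ k)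
      (Submonoid.closure {detSigma k, detPhi k}))
  .trans _ (MvPolynomial (Fin 8) k ⧸ polyJ k) _

lemma isCohenMacaulayRing_SbarQuot (k : Type*) [Field k] : IsCohenMacaulayRing (SbarQuot k) :=
  .of_isIntegral_of_isLocalization (S := MvPolynomial (Fin 8) k ⧸ polyJ k)
    (Algebra.algebraMapSubmonoid _ (Submonoid.closure {detSigma k, detPhi k}))
    (.mvPolynomial (k := k) 4)

lemma ringKrullDim_SbarQuot_le (k : Type*) [Field k] : ringKrullDim (SbarQuot k) ≤ 4 := by
  refine (ringKrullDim_le_of_isIntegral_of_isLocalization (R := MvPolynomial (Fin 4) k)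
    (S := MvPolynomial (Fin 8) k ⧸ polyJ k)
    (Algebra.algebraMapSubmonoid _ (Submonoid.closure {detSigma k, detPhi k}))).trans ?_
  rw [MvPolynomial.ringKrullDim_of_isNoetherianRing, ringKrullDim_eq_zero_of_field]
  simp

/-- Evaluation on `S̄ ⧸ (I₁ ∩ I_N)` at the point where `P = 1` and all other coordinates vanish. -/
lemma exists_SbarQuot_eval (k : Type*) [Field k] : ∃ ε : SbarQuot k →+* k,
    ∀ p : MvPolynomial (Fin 8) k, ε (Ideal.Quotient.mk _ (algebraMap _ (Sbar k) p)) =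
      eval ![0, 0, 0, 0, 1, 0, 0, 0] p := by
  have hu (y : Submonoid.closure {detSigma k, detPhi k}) :
      IsUnit (eval ![0, 0, 0, 0, 1, 0, 0, 0] (y : MvPolynomial (Fin 8) k)) := by
    refine (Submonoid.closure_le.mpr ?_ : Submonoid.closure {detSigma k, detPhi k} ≤
      (IsUnit.submonoid k).comap (eval ![0, 0, 0, 0, 1, 0, 0, 0])) y.2
    simp [Set.insert_subset_iff, detSigma, detPhi, IsUnit.mem_submonoid_iff]
  refine ⟨Ideal.Quotient.lift _ (IsLocalization.lift hu) fun x hx ↦ ?_, fun p ↦ by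
    rw [Ideal.Quotient.lift_mk, IsLocalization.lift_eq]⟩
  rw [← RingHom.mem_ker]
  refine (Ideal.map_le_iff_le_comap.mpr (Ideal.span_le.mpr ?_) :
    (polyJ k).map (algebraMap _ (Sbar k)) ≤ _) hx
  simp [Set.insert_subset_iff, RingHom.mem_ker]

lemma four_le_ringKrullDim_SbarQuot (k : Type*) [Field k] : 4 ≤ ringKrullDim (SbarQuot k) := by
  obtain ⟨ε, hε⟩ := exists_SbarQuot_eval k
  have := RingHom.ker_isPrime ε
  have hX (i : Fin 4) : algebraMap (MvPolynomial (Fin 4) k) (SbarQuot k) (X i) =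
      Ideal.Quotient.mk _ (algebraMap (MvPolynomial (Fin 8) k)
        (Sbar k) (![X 4, X 5, X 1 + X 6, X 2 + X 7] i)) := by
    change Ideal.Quotient.mk _ (algebraMap _ (Sbar k) (paramHom k (X i))) = _
    rw [paramHom, aeval_X]
  have h4 : 4 ≤ ((RingHom.ker ε).under (MvPolynomial (Fin 4) k)).height := by
    refine four_le_height_ker (ε.comp (algebraMap _ _)) ?_ ?_ ?_ ?_ <;>
      · rw [RingHom.comp_apply, hX, hε]
        simp
  have h := Ideal.height_eq_height_add_of_liesOver_of_hasGoingDown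
    ((RingHom.ker ε).under (MvPolynomial (Fin 4) k)) (RingHom.ker ε)
  have : (4 : ℕ∞) ≤ (RingHom.ker ε).height := h4.trans (h ▸ le_self_add)
  exact (WithBot.coe_le_coe.mpr this).trans Ideal.height_le_ringKrullDim_of_isPrime

/-- Let `k` be a field of characteristic `2`.  With
`I₁ = (A,B,C,D)` and `I_N = (A²+BC, CQ+BR, T, A+D)` in `S̄`, one has
`I₁ ∩ I_N = (A+D, AT, BT, CT, A²+BC, BR+CQ)`, `I₁ + I_N = (A,B,C,D,T)`, and
`S̄/(I₁ ∩ I_N)` is Cohen–Macaulay of dimension `4`. -/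
theorem stmt15 {k : Type*} [Field k] [CharP k 2] :
    Ione k ⊓ IN k = Ideal.span {toSbar k (X 0 + X 3), toSbar k (X 0 * X 7),
      toSbar k (X 1 * X 7), toSbar k (X 2 * X 7), toSbar k (X 0 ^ 2 + X 1 * X 2),
      toSbar k (X 1 * X 6 + X 2 * X 5)} ∧
    Ione k ⊔ IN k = Ideal.span {toSbar k (X 0), toSbar k (X 1), toSbar k (X 2),
      toSbar k (X 3), toSbar k (X 7)} ∧
    IsCohenMacaulayRing (Sbar k ⧸ (Ione k ⊓ IN k)) ∧
    ringKrullDim (Sbar k ⧸ (Ione k ⊓ IN k)) = 4 := by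
  refine ⟨Ione_inf_IN k, Ione_sup_IN k, ?_⟩
  rw [Ione_inf_IN_eq_map]
  exact ⟨isCohenMacaulayRing_SbarQuot k,
    (ringKrullDim_SbarQuot_le k).antisymm (four_le_ringKrullDim_SbarQuot k)⟩
end

section
/- Let R be a Noetherian local ring, and let I₁, I₂ be ideals such that R/I₁ and R/I₂ are Cohen–Macaulay of dimension d, and R/(I₁ + I₂) is Cohen–Macaulay of dimension d − 1. Then R/(I₁ ∩ I₂) is Cohen–Macaulay of dimension d. -/
open CategoryTheory Abelian

/-- The Krull dimension of `R ⧸ (I ⊓ J)` is the maximum of those of `R ⧸ I` and `R ⧸ J`. -/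
theorem ringKrullDim_quotient_inf {R : Type*} [CommRing R] (I J : Ideal R) :
    ringKrullDim (R ⧸ (I ⊓ J)) = max (ringKrullDim (R ⧸ I)) (ringKrullDim (R ⧸ J)) := by
  refine le_antisymm ?_ (max_le
    (ringKrullDim_le_of_surjective _ (Ideal.Quotient.factor_surjective inf_le_left))
    (ringKrullDim_le_of_surjective _ (Ideal.Quotient.factor_surjective inf_le_right)))
  simp only [ringKrullDim_quotient]
  refine iSup_le fun p => ?_
  have key (K : Ideal R) (h : K ≤ p.head.1.asIdeal) :
      (p.length : WithBot ℕ∞) ≤ Order.krullDim (PrimeSpectrum.zeroLocus (K : Set R)) :=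
    Order.LTSeries.length_le_krullDim
      { length := p.length
        toFun := fun i => ⟨(p i).1, h.trans (p.head_le i)⟩
        step := p.step }
  obtain h | h := p.head.1.isPrime.inf_le.mp p.head.2
  · exact (key I h).trans (le_max_left _ _)
  · exact (key J h).trans (le_max_right _ _)

section Ext

universe w v u

variable {C : Type u} [Category.{v} C] [Abelian C] [HasExt.{w} C] {S : ShortComplex C}

namespace CategoryTheory.ShortComplex.ShortExact

theorem subsingleton_ext_middle (hS : S.ShortExact) (X : C) (n : ℕ)
    (h₁ : Subsingleton (Ext X S.X₁ n)) (h₃ : Subsingleton (Ext X S.X₃ n)) :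
    Subsingleton (Ext X S.X₂ n) := by
  refine subsingleton_of_forall_eq 0 fun x => ?_
  obtain ⟨y, rfl⟩ := Ext.covariant_sequence_exact₂ X hS x (Subsingleton.elim _ _)
  rw [Subsingleton.elim y 0, Ext.zero_comp]

theorem subsingleton_ext_left (hS : S.ShortExact) (X : C) {d : ℕ}
    (h₂ : ∀ i < d, Subsingleton (Ext X S.X₂ i))
    (h₃ : ∀ i < d - 1, Subsingleton (Ext X S.X₃ i)) :
    ∀ i < d, Subsingleton (Ext X S.X₁ i) := by
  rintro (_ | i) hi
  · have := h₂ 0 hi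
    have := hS.mono_f
    exact (Ext.postcomp_mk₀_injective_of_mono X S.f).subsingleton
  · have := h₂ _ hi
    have := h₃ i (by omega)
    refine subsingleton_of_forall_eq 0 fun x => ?_
    obtain ⟨y, rfl⟩ := Ext.covariant_sequence_exact₁ X hS x (Subsingleton.elim _ _) rfl
    rw [Subsingleton.elim y 0, Ext.zero_comp]

end CategoryTheory.ShortComplex.ShortExact

end Ext

section Modules

universe u

variable {R : Type u} [CommRing R]

theorem ModuleCat.subsingleton_ext_prod (X : ModuleCat.{u} R) (M N : Type u) [AddCommGroup M]
    [Module R M] [AddCommGroup N] [Module R N] (n : ℕ)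
    (hM : Subsingleton (Ext X (ModuleCat.of R M) n))
    (hN : Subsingleton (Ext X (ModuleCat.of R N) n)) :
    Subsingleton (Ext X (ModuleCat.of R (M × N)) n) := by
  have hS : (ShortComplex.mk (ModuleCat.ofHom (LinearMap.inl R M N))
      (ModuleCat.ofHom (LinearMap.snd R M N)) (by ext; simp)).ShortExact :=
    ModuleCat.shortComplex_shortExact _ Function.Exact.inl_snd LinearMap.inl_injective
      LinearMap.snd_surjective
  exact hS.subsingleton_ext_middle X n hM hN

namespace Ideal

variable (I J : Ideal R)

/-- The diagonal map `R ⧸ (I ⊓ J) → R ⧸ I × R ⧸ J` of the Mayer–Vietoris sequence. -/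
def quotientInfToProd : (R ⧸ (I ⊓ J)) →ₗ[R] (R ⧸ I) × (R ⧸ J) :=
  (Submodule.factor inf_le_left).prod (Submodule.factor inf_le_right)

/-- The difference map `R ⧸ I × R ⧸ J → R ⧸ (I ⊔ J)` of the Mayer–Vietoris sequence. -/
def quotientProdToSup : (R ⧸ I) × (R ⧸ J) →ₗ[R] R ⧸ (I ⊔ J) :=
  (Submodule.factor le_sup_left).coprod (-Submodule.factor le_sup_right)

theorem quotientInfToProd_injective : Function.Injective (quotientInfToProd I J) := by
  rw [injective_iff_map_eq_zero]
  intro x hx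
  obtain ⟨r, rfl⟩ := Submodule.Quotient.mk_surjective _ x
  obtain ⟨h₁, h₂⟩ := Prod.ext_iff.mp hx
  exact (Submodule.Quotient.mk_eq_zero _).mpr
    ⟨(Submodule.Quotient.mk_eq_zero _).mp h₁, (Submodule.Quotient.mk_eq_zero _).mp h₂⟩

theorem quotientProdToSup_surjective : Function.Surjective (quotientProdToSup I J) := by
  intro x
  obtain ⟨r, rfl⟩ := Submodule.Quotient.mk_surjective _ x
  exact ⟨(Submodule.Quotient.mk r, 0), by simp [quotientProdToSup]⟩

theorem exact_quotientInfToProd_quotientProdToSup :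
    Function.Exact (quotientInfToProd I J) (quotientProdToSup I J) := by
  rintro ⟨x, y⟩
  obtain ⟨a, rfl⟩ := Submodule.Quotient.mk_surjective _ x
  obtain ⟨b, rfl⟩ := Submodule.Quotient.mk_surjective _ y
  have h : quotientProdToSup I J (Submodule.Quotient.mk a, Submodule.Quotient.mk b) =
      Submodule.Quotient.mk (a - b) := by
    simp [quotientProdToSup, sub_eq_add_neg]
  rw [h, Submodule.Quotient.mk_eq_zero]
  constructor
  · intro hab
    obtain ⟨i, hi, j, hj, hij⟩ := Submodule.mem_sup.mp hab
    refine ⟨Submodule.Quotient.mk (a - i), Prod.ext ?_ ?_⟩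
    · exact (Submodule.Quotient.eq _).mpr (by simpa using hi)
    · exact (Submodule.Quotient.eq _).mpr (by
        rw [LinearMap.id_apply]
        rwa [show a - i - b = j by linear_combination -hij])
  · rintro ⟨z, hz⟩
    obtain ⟨r, rfl⟩ := Submodule.Quotient.mk_surjective _ z
    obtain ⟨h₁, h₂⟩ := Prod.ext_iff.mp hz
    have h₁ : r - a ∈ I := (Submodule.Quotient.eq _).mp h₁
    have h₂ : r - b ∈ J := (Submodule.Quotient.eq _).mp h₂
    rw [show a - b = -(r - a) + (r - b) by ring]
    exact add_mem (neg_mem (mem_sup_left h₁)) (mem_sup_right h₂)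

/-- If `Ext X (R ⧸ I)` and `Ext X (R ⧸ J)` vanish below degree `d` and `Ext X (R ⧸ (I ⊔ J))`
vanishes below degree `d - 1`, then `Ext X (R ⧸ (I ⊓ J))` vanishes below degree `d`. -/
theorem subsingleton_ext_quotient_inf (X : ModuleCat.{u} R) {d : ℕ}
    (hI : ∀ i < d, Subsingleton (Ext X (ModuleCat.of R (R ⧸ I)) i))
    (hJ : ∀ i < d, Subsingleton (Ext X (ModuleCat.of R (R ⧸ J)) i))
    (hIJ : ∀ i < d - 1, Subsingleton (Ext X (ModuleCat.of R (R ⧸ (I ⊔ J))) i)) :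
    ∀ i < d, Subsingleton (Ext X (ModuleCat.of R (R ⧸ (I ⊓ J))) i) := by
  have hexact := exact_quotientInfToProd_quotientProdToSup I J
  have hS : (ShortComplex.mk (ModuleCat.ofHom (quotientInfToProd I J))
      (ModuleCat.ofHom (quotientProdToSup I J))
      (ModuleCat.hom_ext hexact.linearMap_comp_eq_zero)).ShortExact :=
    ModuleCat.shortComplex_shortExact _ hexact (quotientInfToProd_injective I J)
      (quotientProdToSup_surjective I J)
  exact hS.subsingleton_ext_left X
    (fun i hi => ModuleCat.subsingleton_ext_prod X _ _ i (hI i hi) (hJ i hi)) hIJ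

end Ideal

/-- The Rees theorem for a nontrivial finite module over a Noetherian local ring. -/
theorem IsLocalRing.exists_isRegular_iff_subsingleton_ext [IsLocalRing R] [IsNoetherianRing R]
    (M : Type u) [AddCommGroup M] [Module R M] [Module.Finite R M] [Nontrivial M] (n : ℕ) :
    (∃ rs : List R, rs.length = n ∧ (∀ r ∈ rs, r ∈ maximalIdeal R) ∧
      RingTheory.Sequence.IsRegular M rs) ↔
    ∀ i < n, Subsingleton (Ext (ModuleCat.of R (Shrink.{u} (R ⧸ maximalIdeal R)))
      (ModuleCat.of R M) i) := by
  have hlt : maximalIdeal R • (⊤ : Submodule R M) < ⊤ :=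
    (Submodule.top_ne_ideal_smul_of_le_jacobson_annihilator
      (maximalIdeal_le_jacobson _)).symm.lt_top
  exact (ModuleCat.exists_isRegular_tfae (maximalIdeal R) n (ModuleCat.of R M) hlt).out 3 1

end Modules


/-- Eisenbud, Exercise 18.13.  Let `R` be a Noetherian local ring and
`I₁, I₂` ideals such that `R/I₁` and `R/I₂` are Cohen–Macaulay of dimension `d` (as
`R`-modules: Krull dimension `d` and admitting a regular sequence of length `d` in the
maximal ideal), and `R/(I₁ + I₂)` is Cohen–Macaulay of dimension `d − 1`.  Then
`R/(I₁ ∩ I₂)` is Cohen–Macaulay of dimension `d`. -/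
theorem stmt16 {R : Type*} [CommRing R] [IsLocalRing R] [IsNoetherianRing R]
    (I₁ I₂ : Ideal R) (d : ℕ) (hd : 0 < d)
    (hdim1 : ringKrullDim (R ⧸ I₁) = d)
    (hdim2 : ringKrullDim (R ⧸ I₂) = d)
    (hCM1 : ∃ rs : List R, rs.length = d ∧ (∀ r ∈ rs, r ∈ IsLocalRing.maximalIdeal R) ∧
      RingTheory.Sequence.IsRegular (R ⧸ I₁) rs)
    (hCM2 : ∃ rs : List R, rs.length = d ∧ (∀ r ∈ rs, r ∈ IsLocalRing.maximalIdeal R) ∧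
      RingTheory.Sequence.IsRegular (R ⧸ I₂) rs)
    (hdim12 : ringKrullDim (R ⧸ (I₁ ⊔ I₂)) = (d - 1 : ℕ))
    (hCM12 : ∃ rs : List R, rs.length = d - 1 ∧
      (∀ r ∈ rs, r ∈ IsLocalRing.maximalIdeal R) ∧
      RingTheory.Sequence.IsRegular (R ⧸ (I₁ ⊔ I₂)) rs) :
    ringKrullDim (R ⧸ (I₁ ⊓ I₂)) = d ∧
    ∃ rs : List R, rs.length = d ∧ (∀ r ∈ rs, r ∈ IsLocalRing.maximalIdeal R) ∧
      RingTheory.Sequence.IsRegular (R ⧸ (I₁ ⊓ I₂)) rs := by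
  refine ⟨by rw [ringKrullDim_quotient_inf, hdim1, hdim2, max_self], ?_⟩
  have nontrivial_of_isRegular {M : Type _} [AddCommGroup M] [Module R M] {n : ℕ}
      (h : ∃ rs : List R, rs.length = n ∧ (∀ r ∈ rs, r ∈ IsLocalRing.maximalIdeal R) ∧
        RingTheory.Sequence.IsRegular M rs) : Nontrivial M := by
    obtain ⟨_, _, _, hrs⟩ := h
    exact hrs.nontrivial
  have h₁ := nontrivial_of_isRegular hCM1
  have h₂ := nontrivial_of_isRegular hCM2
  have h₁₂ := nontrivial_of_isRegular hCM12
  have : Nontrivial (R ⧸ (I₁ ⊓ I₂)) :=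
    (Ideal.Quotient.factor_surjective (inf_le_left : I₁ ⊓ I₂ ≤ I₁)).nontrivial
  rw [IsLocalRing.exists_isRegular_iff_subsingleton_ext] at hCM1 hCM2 hCM12 ⊢
  exact Ideal.subsingleton_ext_quotient_inf I₁ I₂ _ hCM1 hCM2 hCM12
end
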